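/- arXiv:math/0505542 — 3 statements merged into one kernel-verified Lean document; each statement's English description precedes it below -/
import Mathlib

section
/- For every integer k ≥ 1 there exists a function f_k : ℂ → ℂ such that: (a) f_k is complex differentiable at every point of ℂ \ {1}; (b) for every x ∈ ℂ with |x| < 1 the series ∑_{d=1}^∞ d^k x^d converges with sum f_k(x); and (c) for every x ∈ ℂ with x ≠ 0 and x ≠ 1 one has f_k(x⁻¹) = (-1)^{k+1} f_k(x). In other words, the power series ∑_{d>0} d^k x^d has an analytic continuation f_k to ℂ \ {1} satisfying f_k(x⁻¹) = (-1)^{k+1} f_k(x). -/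
/-- Applying `x d/dx` termwise to the power series `∑ d^k x^d` inside the unit disc. -/
theorem hasSum_pow_succ_mul_geometric_of_hasSum {k : ℕ} {f : ℂ → ℂ}
    (hf : ∀ x : ℂ, ‖x‖ < 1 → HasSum (fun d : ℕ => (d : ℂ) ^ k * x ^ d) (f x))
    {x : ℂ} (hx : ‖x‖ < 1) :
    HasSum (fun d : ℕ => (d : ℂ) ^ (k + 1) * x ^ d) (x * deriv f x) := by
  obtain ⟨r, hxr, hr⟩ := exists_between hx
  have hr0 : 0 ≤ r := (norm_nonneg x).trans hxr.le
  have hu : Summable (fun d : ℕ => (d : ℝ) ^ k * r ^ d) :=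
    summable_pow_mul_geometric_of_norm_lt_one k (by rwa [Real.norm_of_nonneg hr0])
  have hxU : x ∈ Metric.ball (0 : ℂ) r := by simpa using hxr
  have hsum := Complex.hasSum_deriv_of_summable_norm
    (F := fun (d : ℕ) (w : ℂ) => (d : ℂ) ^ k * w ^ d) hu
    (fun d => by fun_prop) Metric.isOpen_ball
    (fun d w hw => by
      have hw' : ‖w‖ ≤ r := by simpa using (mem_ball_zero_iff.mp hw).le
      rw [norm_mul, norm_pow, norm_pow, Complex.norm_natCast]
      gcongr) hxU
  have heq : (fun w : ℂ => ∑' d : ℕ, (d : ℂ) ^ k * w ^ d) =ᶠ[nhds x] f := by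
    filter_upwards [Metric.isOpen_ball.mem_nhds hxU] with w hw
    exact (hf w ((mem_ball_zero_iff.mp hw).trans hr)).tsum_eq
  rw [heq.deriv_eq] at hsum
  refine (hsum.mul_left x).congr_fun fun d => ?_
  cases d with
  | zero => simp
  | succ n =>
    simp only [deriv_const_mul_field, deriv_pow_field, Nat.add_sub_cancel]
    ring

/-- If `f x⁻¹ = c * f x` away from `0` and `1`, then `x f'(x)` satisfies the same functional
equation with the opposite sign. -/
theorem inv_mul_deriv_inv_of_forall_apply_inv {f : ℂ → ℂ} {c : ℂ}
    (hd : ∀ x : ℂ, x ≠ 1 → DifferentiableAt ℂ f x)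
    (hf : ∀ x : ℂ, x ≠ 0 → x ≠ 1 → f x⁻¹ = c * f x) {x : ℂ} (hx0 : x ≠ 0) (hx1 : x ≠ 1) :
    x⁻¹ * deriv f x⁻¹ = -c * (x * deriv f x) := by
  have hleft : HasDerivAt (fun y : ℂ => f y⁻¹) (deriv f x⁻¹ * -(x ^ 2)⁻¹) x :=
    (hd x⁻¹ (by simpa using hx1)).hasDerivAt.comp x (hasDerivAt_inv hx0)
  have hright : HasDerivAt (fun y : ℂ => c * f y) (c * deriv f x) x :=
    (hd x hx1).hasDerivAt.const_mul c
  have heq : (fun y : ℂ => f y⁻¹) =ᶠ[nhds x] fun y => c * f y := by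
    filter_upwards [isOpen_ne.mem_nhds hx0, isOpen_ne.mem_nhds hx1] with y hy0 hy1
    exact hf y hy0 hy1
  have h := (hright.congr_of_eventuallyEq heq).unique hleft
  calc x⁻¹ * deriv f x⁻¹ = -(x * (deriv f x⁻¹ * -(x ^ 2)⁻¹)) := by field_simp
    _ = -c * (x * deriv f x) := by rw [← h]; ring

/-- Lemma 4.1: for every `k ≥ 1` the power series `∑_{d>0} d^k x^d` has an
analytic continuation `f_k` to `ℂ \ {1}` satisfying `f_k(x⁻¹) = (-1)^(k+1) f_k(x)`. -/
theorem analytic_continuation_of_polylog_series (k : ℕ) (hk : 1 ≤ k) :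
    ∃ f : ℂ → ℂ,
      (∀ x : ℂ, x ≠ 1 → DifferentiableAt ℂ f x) ∧
      (∀ x : ℂ, ‖x‖ < 1 → HasSum (fun d : ℕ => (d : ℂ) ^ k * x ^ d) (f x)) ∧
      (∀ x : ℂ, x ≠ 0 → x ≠ 1 → f x⁻¹ = (-1) ^ (k + 1) * f x) := by
  induction k, hk using Nat.le_induction with
  | base =>
    refine ⟨fun x => x / (1 - x) ^ 2, fun x hx => ?_, fun x hx => ?_, fun x hx0 hx1 => ?_⟩
    · have : (1 - x) ^ 2 ≠ 0 := pow_ne_zero 2 (sub_ne_zero.mpr hx.symm)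
      fun_prop (disch := assumption)
    · simpa using hasSum_coe_mul_geometric_of_norm_lt_one hx
    · have h1 : 1 - x ≠ 0 := sub_ne_zero.mpr hx1.symm
      have h2 : x - 1 ≠ 0 := sub_ne_zero.mpr hx1
      have h3 : 1 - x⁻¹ = (x - 1) / x := by field_simp
      simp only [h3]
      field_simp
      ring
  | succ k _ ih =>
    obtain ⟨f, hd, hs, hi⟩ := ih
    refine ⟨fun x => x * deriv f x, fun x hx => ?_,
      fun x hx => hasSum_pow_succ_mul_geometric_of_hasSum hs hx, fun x hx0 hx1 => ?_⟩
    · have hon : DifferentiableOn ℂ f {y | y ≠ 1} :=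
        fun y hy => (hd y hy).differentiableWithinAt
      exact differentiableAt_id.mul
        ((hon.deriv isOpen_ne).differentiableAt (isOpen_ne.mem_nhds hx))
    · rw [pow_succ, mul_neg_one]
      exact inv_mul_deriv_inv_of_forall_apply_inv hd hi hx0 hx1
end

section
/- Define a sequence of functions f_k : ℂ → ℂ recursively by f_1(x) = x/(1-x)^2 and f_{k+1}(x) = x · f_k'(x) (where f_k' denotes the complex derivative of f_k). Then for every odd integer k ≥ 1 and every x ∈ ℂ with x ≠ 0 and x ≠ 1, one has f_k(x⁻¹) = f_k(x). -/
open Complex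

/-- The sequence of rational functions from Lemma 4.1:
`f 1 x = x / (1 - x)^2` and `f (k+1) x = x * (f k)'(x)`.
(The value at index `0` is irrelevant and set to `0`.) -/
noncomputable def flopF : ℕ → ℂ → ℂ
  | 0 => fun _ => 0
  | 1 => fun x => x / (1 - x) ^ 2
  | (k + 2) => fun x => x * deriv (flopF (k + 1)) x

theorem differentiableOn_flopF_succ (k : ℕ) :
    DifferentiableOn ℂ (flopF (k + 1)) {1}ᶜ := by
  induction k with
  | zero =>
    intro x hx
    have h : (1 - x) ^ 2 ≠ 0 := pow_ne_zero 2 (sub_ne_zero.mpr (Ne.symm hx))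
    have hd : DifferentiableAt ℂ (fun x : ℂ => x / (1 - x) ^ 2) x := by
      fun_prop (disch := assumption)
    exact hd.differentiableWithinAt
  | succ k ih => exact differentiableOn_id.mul (ih.deriv isOpen_compl_singleton)

/-- The functional equation `f_{k+1}(x⁻¹) = (-1)^k f_{k+1}(x)`. -/
theorem flopF_succ_inv (k : ℕ) {x : ℂ} (hx0 : x ≠ 0) (hx1 : x ≠ 1) :
    flopF (k + 1) x⁻¹ = (-1) ^ k * flopF (k + 1) x := by
  induction k generalizing x with
  | zero =>
    simp only [flopF]
    field_simp
    ring
  | succ k ih =>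
    have hinv : x⁻¹ ≠ 1 := inv_ne_one.mpr hx1
    have hd : HasDerivAt (flopF (k + 1)) (deriv (flopF (k + 1)) x⁻¹) x⁻¹ :=
      ((differentiableOn_flopF_succ k).differentiableAt
        (isOpen_compl_singleton.mem_nhds hinv)).hasDerivAt
    have heq : (fun y => flopF (k + 1) y⁻¹) =ᶠ[nhds x]
        fun y => (-1) ^ k * flopF (k + 1) y := by
      filter_upwards [isOpen_ne.mem_nhds hx0, isOpen_ne.mem_nhds hx1] with y hy0 hy1
      exact ih hy0 hy1
    have hderiv : deriv (flopF (k + 1)) x⁻¹ * -(x ^ 2)⁻¹ =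
        (-1) ^ k * deriv (flopF (k + 1)) x := by
      rw [← deriv_const_mul_field, ← heq.deriv_eq]
      exact (hd.comp x (hasDerivAt_inv hx0)).deriv.symm
    simp only [flopF]
    rw [pow_succ, mul_neg_one, neg_mul, mul_left_comm, ← hderiv]
    field_simp

/-- Remark after Lemma 4.1: for odd `k ≥ 1`, the function `f_k` is invariant
under `x ↦ x⁻¹` on `ℂ \ {0, 1}`. -/
theorem flopF_inv_of_odd (k : ℕ) (hk : 1 ≤ k) (hodd : Odd k)
    (x : ℂ) (hx0 : x ≠ 0) (hx1 : x ≠ 1) :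
    flopF k x⁻¹ = flopF k x := by
  obtain ⟨m, rfl⟩ := hodd
  rw [flopF_succ_inv (2 * m) hx0 hx1, (even_two_mul m).neg_one_pow, one_mul]
end

section
/- Define a sequence of functions f_k : ℂ → ℂ recursively by f_1(x) = x/(1-x)^2 and f_{k+1}(x) = x · f_k'(x) (where f_k' denotes the complex derivative of f_k). Then for every integer k ≥ 1 and every x ∈ ℂ with x ≠ 0 and x ≠ 1, one has f_k'(x⁻¹) = (-1)^k · x^2 · f_k'(x). -/
open Complex

/-- Each `flopF k` is holomorphic away from `1`. -/
theorem differentiableOn_flopF (k : ℕ) : DifferentiableOn ℂ (flopF k) {1}ᶜ := by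
  induction k using flopF.induct with
  | case1 => exact differentiableOn_const 0
  | case2 =>
    refine DifferentiableOn.div (by fun_prop) (by fun_prop) fun x hx => ?_
    exact pow_ne_zero 2 (sub_ne_zero.mpr (Ne.symm hx))
  | case3 k ih => exact differentiableOn_id.mul (ih.deriv isOpen_compl_singleton)

/-- If `f` is differentiable at `x⁻¹` and satisfies `f y⁻¹ = c * f y` near `x`, then the
derivatives of `f` at `x⁻¹` and `x` differ by the factor `-c * x ^ 2`. -/
theorem deriv_inv_of_eventually_inv_eq {f : ℂ → ℂ} {c x : ℂ} (hx : x ≠ 0)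
    (hf : DifferentiableAt ℂ f x⁻¹) (h : ∀ᶠ y in nhds x, f y⁻¹ = c * f y) :
    deriv f x⁻¹ = -c * x ^ 2 * deriv f x := by
  have hcomp : deriv (fun y => f y⁻¹) x = deriv f x⁻¹ * -(x ^ 2)⁻¹ :=
    (hf.hasDerivAt.comp x (hasDerivAt_inv hx)).deriv
  rw [Filter.EventuallyEq.deriv_eq h, deriv_const_mul_field] at hcomp
  linear_combination x ^ 2 * hcomp - deriv f x⁻¹ * mul_inv_cancel₀ (pow_ne_zero 2 hx)

/-- The functional equation implies the corresponding identity for the derivatives. -/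
theorem deriv_flopF_inv_of_flopF_inv {k : ℕ}
    (h : ∀ x : ℂ, x ≠ 0 → x ≠ 1 → flopF k x⁻¹ = (-1) ^ (k + 1) * flopF k x)
    {x : ℂ} (hx0 : x ≠ 0) (hx1 : x ≠ 1) :
    deriv (flopF k) x⁻¹ = (-1) ^ k * x ^ 2 * deriv (flopF k) x := by
  have hf : DifferentiableAt ℂ (flopF k) x⁻¹ :=
    (differentiableOn_flopF k).differentiableAt
      (isOpen_compl_singleton.mem_nhds (inv_ne_one.mpr hx1))
  have hev : ∀ᶠ y in nhds x, flopF k y⁻¹ = (-1) ^ (k + 1) * flopF k y := by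
    filter_upwards [isOpen_ne.mem_nhds hx0, isOpen_ne.mem_nhds hx1] with y hy0 hy1
    exact h y hy0 hy1
  rw [deriv_inv_of_eventually_inv_eq hx0 hf hev]
  ring

/-- The functional equation `f_k(x⁻¹) = (-1)^(k+1) f_k(x)`. -/
theorem flopF_inv (k : ℕ) (x : ℂ) (hx0 : x ≠ 0) (hx1 : x ≠ 1) :
    flopF k x⁻¹ = (-1) ^ (k + 1) * flopF k x := by
  induction k using flopF.induct generalizing x with
  | case1 => simp [flopF]
  | case2 =>
    have h1 : 1 - x ≠ 0 := sub_ne_zero.mpr hx1.symm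
    have h2 : x - 1 ≠ 0 := sub_ne_zero.mpr hx1
    have h3 : 1 - x⁻¹ = (x - 1) / x := by field_simp
    simp only [flopF, h3]
    field_simp
    ring
  | case3 k ih =>
    simp only [flopF]
    rw [deriv_flopF_inv_of_flopF_inv ih hx0 hx1, pow_succ _ (k + 2), pow_succ _ (k + 1)]
    linear_combination (-1) ^ (k + 1) * x * deriv (flopF (k + 1)) x * mul_inv_cancel₀ hx0

/-- Derivative identity from the proof of Lemma 4.1:
`f_k'(x⁻¹) = (-1)^k · x² · f_k'(x)` for all `k ≥ 1` and `x ∈ ℂ \ {0, 1}`. -/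
theorem deriv_flopF_inv (k : ℕ) (hk : 1 ≤ k) (x : ℂ) (hx0 : x ≠ 0) (hx1 : x ≠ 1) :
    deriv (flopF k) x⁻¹ = (-1) ^ k * x ^ 2 * deriv (flopF k) x := by
  exact deriv_flopF_inv_of_flopF_inv (flopF_inv k) hx0 hx1
end
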